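/- Let G be a finite 2-connected simple graph and let u and w be two distinct vertices of G. Then there exist two paths from u to w in G whose only common vertices are u and w. -/

import Mathlib

/-- A finite simple graph is 2-connected: at least 3 vertices, connected, and
no cut vertex (deleting any single vertex leaves a connected graph). -/
def SimpleGraph.TwoConnected {V : Type*} [Fintype V] (G : SimpleGraph V) : Prop :=
  3 ≤ Fintype.card V ∧ G.Connected ∧
    ∀ v : V, (G.induce ({v}ᶜ : Set V)).Connected

namespace TwoConnAux

/-- Truncate a walk at its first vertex in `S`. -/
lemma exists_first {V : Type*} {G : SimpleGraph V} (S : Set V) {a b : V} (r : G.Walk a b)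
    (hb : b ∈ S) : ∃ (x : V) (r' : G.Walk a x), x ∈ S ∧ r'.support ⊆ r.support ∧
      ∀ y ∈ r'.support, y ∈ S → y = x := by
  induction r with
  | nil => exact ⟨_, .nil, hb, by simp, by simp⟩
  | @cons a c b h p ih =>
    by_cases ha : a ∈ S
    · exact ⟨a, .nil, ha, by simp, by simp⟩
    · obtain ⟨x, r', hx, hs, hy⟩ := ih hb
      refine ⟨x, .cons h r', hx, ?_, ?_⟩
      · simp only [SimpleGraph.Walk.support_cons]
        exact List.cons_subset_cons _ hs
      · intro y hy1 hyS
        rw [SimpleGraph.Walk.support_cons, List.mem_cons] at hy1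
        rcases hy1 with rfl | hy1
        · exact absurd hyS ha
        · exact hy y hy1 hyS

/-- The rerouting step. -/
lemma step {V : Type*} {G : SimpleGraph V} {u v w x : V} (P Q : G.Walk u v)
    (hP : P.IsPath)
    (hd : ∀ y, y ∈ P.support → y ∈ Q.support → y = u ∨ y = v)
    (hx : x ∈ P.support) (hxv : x ≠ v) (r : G.Walk w x)
    (hr : ∀ y ∈ r.support, y ∈ P.support ∨ y ∈ Q.support → y = x) (h : G.Adj v w) :
    ∃ (p q : G.Walk u w), p.IsPath ∧ q.IsPath ∧
      ∀ y : V, y ∈ p.support → y ∈ q.support → y = u ∨ y = w := by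
  classical
  refine ⟨((P.takeUntil x hx).append r.reverse).bypass, (Q.concat h).bypass,
    SimpleGraph.Walk.bypass_isPath _, SimpleGraph.Walk.bypass_isPath _, ?_⟩
  intro y hy1 hy2
  have h1 := SimpleGraph.Walk.support_bypass_subset_support _ hy1
  have h2 := SimpleGraph.Walk.support_bypass_subset_support _ hy2
  rw [SimpleGraph.Walk.mem_support_append_iff, SimpleGraph.Walk.support_reverse,
    List.mem_reverse] at h1
  rw [SimpleGraph.Walk.support_concat, List.mem_append,
    List.mem_singleton] at h2
  rcases h2 with h2 | h2
  · left
    rcases h1 with h1 | h1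
    · rcases hd y (P.support_takeUntil_subset_support hx h1) h2 with e | e
      · exact e
      · subst e
        exact absurd h1 (SimpleGraph.Walk.endpoint_notMem_support_takeUntil hP hx hxv.symm)
    · have e := hr y h1 (Or.inr h2)
      subst e
      exact (hd y hx h2).resolve_right hxv
  · exact Or.inr h2

lemma main {V : Type*} {G : SimpleGraph V}
    (hG : ∀ v : V, (G.induce ({v}ᶜ : Set V)).Connected) {w u : V} (W : G.Walk w u)
    (hne : u ≠ w) :
    ∃ (p q : G.Walk u w), p.IsPath ∧ q.IsPath ∧
      ∀ x : V, x ∈ p.support → x ∈ q.support → x = u ∨ x = w := by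
  induction W with
  | nil => exact absurd rfl hne
  | @cons w v u h p ih =>
    by_cases huv : u = v
    · subst huv
      refine ⟨.cons h.symm .nil, .cons h.symm .nil, ?_, ?_, ?_⟩ <;> simp [hne]
    · obtain ⟨P, Q, hP, hQ, hd⟩ := ih huv
      obtain ⟨r0⟩ := (hG v).preconnected ⟨w, by simpa using h.ne⟩ ⟨u, by simpa using huv⟩
      let r : G.Walk w u := r0.map (SimpleGraph.Embedding.induce _).toHom
      have hrv : v ∉ r.support := by
        intro hv
        replace hv : v ∈ (r0.map (SimpleGraph.Embedding.induce _).toHom).support := hv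
        rw [SimpleGraph.Walk.support_map, List.mem_map] at hv
        obtain ⟨a, -, ha⟩ := hv
        exact a.2 ha
      obtain ⟨x, r', hx, hs, hy⟩ := exists_first {y | y ∈ P.support ∨ y ∈ Q.support} r
        (Or.inl P.start_mem_support)
      have hxv : x ≠ v := fun e => hrv (e ▸ hs r'.end_mem_support)
      rcases hx with hx | hx
      · exact step P Q hP hd hx hxv r' hy h.symm
      · exact step Q P hQ (fun y a b => hd y b a) hx hxv r'
          (fun y a b => hy y a b.symm) h.symm

end TwoConnAux

/-- Between any two distinct vertices of a finite 2-connected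
simple graph there are two paths whose only common vertices are the endpoints. -/
theorem twoConnected_two_internally_disjoint_paths
    {V : Type*} [Fintype V] (G : SimpleGraph V) (hG : G.TwoConnected)
    (u w : V) (hne : u ≠ w) :
    ∃ (p q : G.Walk u w), p.IsPath ∧ q.IsPath ∧
      ∀ x : V, x ∈ p.support → x ∈ q.support → x = u ∨ x = w := by
  obtain ⟨W⟩ := hG.2.1.preconnected w u
  exact TwoConnAux.main hG.2.2 W hne
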